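/- Let N ≥ 1 and let A be a random matrix distributed according to the normalized Haar probability measure on the unitary group U(N). Then for every integer k ≥ 1, the expected value E[|Tr(A^k)|²] = min{k, N}. -/

import Mathlib

open MeasureTheory ProbabilityTheory Matrix

noncomputable section

instance matrixMeasurableSpace {m n α : Type*} [MeasurableSpace α] :
    MeasurableSpace (Matrix m n α) :=
  show MeasurableSpace (m → n → α) from inferInstance

section ElementarySymmetric

open Polynomial

variable {n : Type*} [Fintype n] [DecidableEq n]

/-- The polynomial `det (1 + X A)`. -/
def detOneAdd (A : Matrix n n ℂ) : ℂ[X] := det (1 + (X : ℂ[X]) • A.map C)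

/-- The `b`-th elementary symmetric function of the eigenvalues of `A`. -/
def eigenEsymm (b : ℕ) (A : Matrix n n ℂ) : ℂ := (detOneAdd A).coeff b

lemma eval_detOneAdd (A : Matrix n n ℂ) (s : ℂ) :
    (detOneAdd A).eval s = det (1 + s • A) := by
  rw [detOneAdd, eval_det]
  congr 1
  ext i j
  simp [Matrix.one_apply, mul_comm]

lemma eigenEsymm_zero (A : Matrix n n ℂ) : eigenEsymm 0 A = 1 := by
  rw [eigenEsymm, coeff_zero_eq_eval_zero, eval_detOneAdd]
  simp

lemma eigenEsymm_eq_zero (A : Matrix n n ℂ) {b : ℕ} (hb : Fintype.card n < b) :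
    eigenEsymm b A = 0 := by
  refine coeff_eq_zero_of_natDegree_lt (lt_of_le_of_lt ?_ hb)
  have := natDegree_det_X_add_C_le A (1 : Matrix n n ℂ)
  rw [detOneAdd, add_comm]
  simpa using this

lemma derivative_detOneAdd (A : Matrix n n ℂ) :
    derivative (detOneAdd A) =
      trace (adjugate (1 + (X : ℂ[X]) • A.map C) * A.map C) := by
  have hne : detOneAdd A ≠ 0 := fun h => by
    have := eigenEsymm_zero A
    simp [eigenEsymm, h] at this
  have hinf : {s : ℂ | (detOneAdd A).eval s ≠ 0}.Infinite := by
    have : {s : ℂ | (detOneAdd A).eval s = 0}.Finite := by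
      simpa [IsRoot.def] using finite_setOfPred_isRoot hne
    exact this.infinite_compl
  refine eq_of_infinite_eval_eq _ _ (hinf.mono fun s hs => ?_)
  have hs' : det (1 + s • A) ≠ 0 := by rwa [← eval_detOneAdd]
  have hu : IsUnit (det (1 + s • A)) := isUnit_iff_ne_zero.mpr hs'
  set B := 1 + s • A with hB
  have hcomp : (detOneAdd A).comp (X + C s) =
      C (det B) * detOneAdd (B⁻¹ * A) := by
    refine Polynomial.funext fun r => ?_
    rw [eval_comp, eval_mul, eval_C, eval_detOneAdd, eval_detOneAdd, ← det_mul, mul_add,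
      Matrix.mul_smul, Matrix.mul_nonsing_inv_cancel_left _ _ hu, hB]
    simp only [eval_add, eval_X, eval_C, add_smul]
    rw [add_comm (r • A), mul_one, add_assoc]
  have hder := congrArg (fun q : ℂ[X] => (derivative q).eval 0) hcomp
  have hmat : (evalRingHom s).mapMatrix (1 + (X : ℂ[X]) • A.map C) = B := by
    ext i j
    simp [hB, Matrix.one_apply, apply_ite (eval s)]
    exact mul_comm _ _
  have htr : (trace (adjugate (1 + (X : ℂ[X]) • A.map C) * A.map C)).eval s =
      trace (adjugate B * A) := by
    rw [← hmat, ← RingHom.map_adjugate, ← coe_evalRingHom, Matrix.trace, Matrix.trace, map_sum]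
    simp [Matrix.mul_apply]
  simp only [derivative_comp, derivative_C_mul, eval_mul, eval_C] at hder
  rw [detOneAdd, detOneAdd, derivative_det_one_add_X_smul, ← detOneAdd] at hder
  simp only [Set.mem_ofPred_eq, htr]
  simp [eval_comp] at hder
  rw [hder, ← smul_eq_mul, ← Matrix.trace_smul, ← Matrix.smul_mul, Matrix.inv_def,
    Ring.inverse_eq_inv', smul_smul, mul_inv_cancel₀ hs', one_smul]

/-- The coefficients of the adjugate of `1 + X A` as a polynomial in `X`. -/
def adjCoeff (A : Matrix n n ℂ) (b : ℕ) : Matrix n n ℂ :=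
  (adjugate (1 + (X : ℂ[X]) • A.map C)).map (fun q => q.coeff b)

lemma adjCoeff_zero (A : Matrix n n ℂ) : adjCoeff A 0 = 1 := by
  have h := Matrix.mul_adjugate (1 + (X : ℂ[X]) • A.map C)
  ext i j
  have hij := congrArg (fun q : ℂ[X] => q.coeff 0) (congrFun (congrFun h i) j)
  simp only [add_mul, one_mul, Matrix.smul_mul, Matrix.add_apply, Matrix.smul_apply, smul_eq_mul,
    coeff_add, mul_coeff_zero, coeff_X_zero, zero_mul, add_zero] at hij
  rw [adjCoeff, Matrix.map_apply, hij, ← detOneAdd, ← eigenEsymm, eigenEsymm_zero]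
  simp [Matrix.one_apply, apply_ite (fun q : ℂ[X] => q.coeff 0)]

lemma adjCoeff_succ (A : Matrix n n ℂ) (b : ℕ) :
    adjCoeff A (b + 1) = eigenEsymm (b + 1) A • 1 - A * adjCoeff A b := by
  have h := Matrix.mul_adjugate (1 + (X : ℂ[X]) • A.map C)
  rw [eq_sub_iff_add_eq]
  ext i j
  have hij := congrArg (fun q : ℂ[X] => q.coeff (b + 1)) (congrFun (congrFun h i) j)
  simp only [add_mul, one_mul, Matrix.smul_mul, Matrix.add_apply, Matrix.smul_apply, smul_eq_mul,
    coeff_add, coeff_X_mul] at hij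
  rw [← detOneAdd] at hij
  simp only [Matrix.mul_apply, Matrix.map_apply, finsetSum_coeff, coeff_C_mul] at hij
  simp only [adjCoeff, Matrix.add_apply, Matrix.map_apply, Matrix.mul_apply, hij, eigenEsymm,
    Matrix.smul_apply, Matrix.one_apply, smul_eq_mul]
  split_ifs <;> simp

lemma adjCoeff_eq_sum (A : Matrix n n ℂ) (b : ℕ) :
    adjCoeff A b =
      ∑ j ∈ Finset.range (b + 1), ((-1) ^ j * eigenEsymm (b - j) A) • A ^ j := by
  induction b with
  | zero => simp [adjCoeff_zero, eigenEsymm_zero]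
  | succ b ih =>
    rw [adjCoeff_succ, ih, Finset.sum_range_succ' _ (b + 1), Finset.mul_sum, sub_eq_add_neg,
      ← Finset.sum_neg_distrib, add_comm]
    congr 1
    · refine Finset.sum_congr rfl fun j _ => ?_
      rw [Matrix.mul_smul, ← pow_succ', ← neg_smul, Nat.add_sub_add_right]
      congr 1
      ring
    · simp

/-- Newton's identity for the eigenvalues of a matrix. -/
lemma succ_mul_eigenEsymm_succ (A : Matrix n n ℂ) (b : ℕ) :
    ((b : ℂ) + 1) * eigenEsymm (b + 1) A =
      ∑ j ∈ Finset.range (b + 1), (-1) ^ j * eigenEsymm (b - j) A * trace (A ^ (j + 1)) := by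
  have h := congrArg (fun q : ℂ[X] => q.coeff b) (derivative_detOneAdd A)
  have h2 : (trace (adjugate (1 + (X : ℂ[X]) • A.map C) * A.map C)).coeff b =
      trace (adjCoeff A b * A) := by
    simp [Matrix.trace, Matrix.mul_apply, adjCoeff, finsetSum_coeff]
  simp only [coeff_derivative, h2] at h
  rw [mul_comm, eigenEsymm, h, adjCoeff_eq_sum, Finset.sum_mul, Matrix.trace_sum]
  refine Finset.sum_congr rfl fun j _ => ?_
  rw [Matrix.smul_mul, ← pow_succ, Matrix.trace_smul, smul_eq_mul]

lemma adjCoeff_card (A : Matrix n n ℂ) (hA : IsUnit A) : adjCoeff A (Fintype.card n) = 0 := by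
  have hstep : ∀ m, adjCoeff A (Fintype.card n + m) = (-A) ^ m * adjCoeff A (Fintype.card n) := by
    intro m
    induction m with
    | zero => simp
    | succ m ih =>
      rw [← add_assoc, adjCoeff_succ, ih, eigenEsymm_eq_zero A (by omega), pow_succ']
      simp [mul_assoc]
  have hev : ∃ M, adjCoeff A (Fintype.card n + M) = 0 := by
    set D : n → n → ℕ := fun i j => ((adjugate (1 + (X : ℂ[X]) • A.map C)) i j).natDegree with hD
    refine ⟨∑ i, ∑ j, D i j + 1, ?_⟩
    ext i j
    have h1 : ∑ j, D i j ≤ ∑ i, ∑ j, D i j :=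
      Finset.single_le_sum (f := fun i => ∑ j, D i j) (fun _ _ => Nat.zero_le _)
        (Finset.mem_univ i)
    have h2 : D i j ≤ ∑ j, D i j :=
      Finset.single_le_sum (fun _ _ => Nat.zero_le _) (Finset.mem_univ j)
    refine coeff_eq_zero_of_natDegree_lt (show D i j < _ from ?_)
    omega
  obtain ⟨M, hM⟩ := hev
  rw [hstep] at hM
  exact ((hA.neg.pow M).mul_right_eq_zero).mp hM

/-- The Cayley–Hamilton recursion for traces of powers. -/
lemma sum_eigenEsymm_mul_trace_pow_eq_zero (A : Matrix n n ℂ) (hA : IsUnit A) (m : ℕ) :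
    ∑ j ∈ Finset.range (Fintype.card n + 1),
      (-1) ^ j * eigenEsymm (Fintype.card n - j) A * trace (A ^ (m + j)) = 0 := by
  have h := adjCoeff_card A hA
  rw [adjCoeff_eq_sum] at h
  have h2 := congrArg (fun B => trace (A ^ m * B)) h
  simp only [Finset.mul_sum, Matrix.trace_sum, Matrix.mul_smul, Matrix.trace_smul, ← pow_add,
    smul_eq_mul, mul_zero, Matrix.trace_zero] at h2
  exact h2

end ElementarySymmetric

section TranslationGradient

open scoped Matrix.Norms.Operator

variable {n : Type*} [Fintype n] [DecidableEq n]

/-- `G` is the gradient of `F` for left translation: `d/dt F(exp(tX) A) = Tr(X G(A))` at `t = 0`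
for every skew-Hermitian `X`. -/
structure HasTranslationGrad (F : Matrix n n ℂ → ℂ) (G : Matrix n n ℂ → Matrix n n ℂ) :
    Prop where
  continuous_fun : Continuous F
  continuous_grad : Continuous G
  hasDerivAt : ∀ A X : Matrix n n ℂ, star X = -X →
    HasDerivAt (fun t : ℝ => F (NormedSpace.exp (t • X) * A)) (trace (X * G A)) 0

namespace HasTranslationGrad

variable {F F' : Matrix n n ℂ → ℂ} {G G' : Matrix n n ℂ → Matrix n n ℂ}

lemma mul (h : HasTranslationGrad F G) (h' : HasTranslationGrad F' G') :
    HasTranslationGrad (fun A => F A * F' A) (fun A => F' A • G A + F A • G' A) where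
  continuous_fun := h.continuous_fun.mul h'.continuous_fun
  continuous_grad := (h'.continuous_fun.smul h.continuous_grad).add
    (h.continuous_fun.smul h'.continuous_grad)
  hasDerivAt A X hX := by
    refine ((h.hasDerivAt A X hX).mul (h'.hasDerivAt A X hX)).congr_deriv ?_
    simp [mul_add, Matrix.trace_add, Matrix.trace_smul]
    ring

lemma const (c : ℂ) : HasTranslationGrad (n := n) (fun _ => c) (fun _ => 0) where
  continuous_fun := continuous_const
  continuous_grad := continuous_const
  hasDerivAt A X _ := by simpa using hasDerivAt_const (0 : ℝ) c

lemma const_mul (c : ℂ) (h : HasTranslationGrad F G) :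
    HasTranslationGrad (fun A => c * F A) (fun A => c • G A) := by
  simpa using (const c).mul h

lemma sum {ι : Type*} (s : Finset ι) {F : ι → Matrix n n ℂ → ℂ}
    {G : ι → Matrix n n ℂ → Matrix n n ℂ} (h : ∀ i ∈ s, HasTranslationGrad (F i) (G i)) :
    HasTranslationGrad (fun A => ∑ i ∈ s, F i A) (fun A => ∑ i ∈ s, G i A) where
  continuous_fun := continuous_finsetSum _ fun i hi => (h i hi).continuous_fun
  continuous_grad := continuous_finsetSum _ fun i hi => (h i hi).continuous_grad
  hasDerivAt A X hX := by
    refine (HasDerivAt.fun_sum fun i hi => (h i hi).hasDerivAt A X hX).congr_deriv ?_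
    simp [Finset.mul_sum, Matrix.trace_sum]

end HasTranslationGrad

lemma hasDerivAt_exp_smul_mul (A X : Matrix n n ℂ) :
    HasDerivAt (fun t : ℝ => NormedSpace.exp (t • X) * A) (X * A) 0 := by
  exact ((hasDerivAt_exp_smul_const (𝕂 := ℝ) X (0 : ℝ)).mul_const A).congr_deriv (by simp)

lemma hasDerivAt_exp_smul_mul_pow (A X : Matrix n n ℂ) (j : ℕ) :
    HasDerivAt (fun t : ℝ => (NormedSpace.exp (t • X) * A) ^ j)
      (∑ m ∈ Finset.range j, A ^ m * X * A ^ (j - m)) 0 := by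
  induction j with
  | zero => exact (hasDerivAt_const (0 : ℝ) (1 : Matrix n n ℂ)).congr_deriv (by simp)
  | succ j ih =>
    refine (ih.mul (hasDerivAt_exp_smul_mul A X)).congr_deriv ?_
    rw [Finset.sum_range_succ, Finset.sum_mul]
    simp only [zero_smul, NormedSpace.exp_zero, one_mul]
    congr 1
    · refine Finset.sum_congr rfl fun m hm => ?_
      rw [Nat.sub_add_comm (Finset.mem_range.mp hm).le, pow_succ]
      simp only [mul_assoc]
    · simp [mul_assoc]

lemma hasDerivAt_matrix_apply {m : Type*} [Fintype m] {f : ℝ → Matrix m m ℂ}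
    {f' : Matrix m m ℂ} {t : ℝ} (h : HasDerivAt f f' t) (i j : m) :
    HasDerivAt (fun t => f t i j) (f' i j) t := by
  exact (Matrix.entryLinearMap ℝ ℂ i j :
    Matrix m m ℂ →ₗ[ℝ] ℂ).toContinuousLinearMap.hasFDerivAt.comp_hasDerivAt t h

lemma hasDerivAt_trace {m : Type*} [Fintype m] {f : ℝ → Matrix m m ℂ} {f' : Matrix m m ℂ}
    {t : ℝ} (h : HasDerivAt f f' t) : HasDerivAt (fun t => trace (f t)) (trace f') t :=
  HasDerivAt.fun_sum fun i _ => hasDerivAt_matrix_apply h i i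

lemma hasTranslationGrad_pow_apply (j : ℕ) (r s : n) :
    HasTranslationGrad (fun A : Matrix n n ℂ => (A ^ j) r s)
      (fun A => ∑ m ∈ Finset.range j, A ^ (j - m) * Matrix.single s r 1 * A ^ m) where
  continuous_fun := (continuous_pow j).matrix_elem r s
  continuous_grad := by fun_prop
  hasDerivAt A X _ := by
    refine (hasDerivAt_matrix_apply (hasDerivAt_exp_smul_mul_pow A X j) r s).congr_deriv ?_
    simp only [Finset.mul_sum, Matrix.trace_sum, Matrix.sum_apply]
    refine Finset.sum_congr rfl fun m _ => ?_
    have h : trace (X * (A ^ (j - m) * Matrix.single s r 1 * A ^ m)) =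
        trace (Matrix.single s r 1 * (A ^ m * X * A ^ (j - m))) := by
      rw [← mul_assoc, Matrix.trace_mul_comm, ← mul_assoc, ← mul_assoc, Matrix.trace_mul_comm]
    rw [h, Matrix.trace_single_mul, one_smul]

lemma hasTranslationGrad_trace_pow (j : ℕ) :
    HasTranslationGrad (fun A : Matrix n n ℂ => trace (A ^ j)) (fun A => (j : ℂ) • A ^ j) where
  continuous_fun := (continuous_pow j).matrix_trace
  continuous_grad := by fun_prop
  hasDerivAt A X _ := by
    refine (hasDerivAt_trace (hasDerivAt_exp_smul_mul_pow A X j)).congr_deriv ?_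
    rw [Matrix.trace_sum, Finset.sum_congr rfl (g := fun _ => trace (X * A ^ j))]
    · simp [Matrix.trace_smul]
    · intro m hm
      rw [Matrix.trace_mul_comm, ← mul_assoc, ← pow_add, Matrix.trace_mul_comm,
        Nat.sub_add_cancel (Finset.mem_range.mp hm).le]

lemma hasTranslationGrad_star_trace_pow (j : ℕ) :
    HasTranslationGrad (fun A : Matrix n n ℂ => star (trace (A ^ j)))
      (fun A => -(j : ℂ) • (star A) ^ j) where
  continuous_fun := (hasTranslationGrad_trace_pow j).continuous_fun.star
  continuous_grad := by fun_prop
  hasDerivAt A X hX := by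
    refine ((hasTranslationGrad_trace_pow j).hasDerivAt A X hX).star.congr_deriv ?_
    rw [← Matrix.trace_conjTranspose, ← Matrix.star_eq_conjTranspose, star_mul, star_smul,
      star_pow, hX, Matrix.trace_mul_comm]
    simp

/-- The gradient of the elementary symmetric function `eigenEsymm b`. -/
def eigenEsymmGrad (b : ℕ) (A : Matrix n n ℂ) : Matrix n n ℂ :=
  ∑ l ∈ Finset.range b, ((-1) ^ l * eigenEsymm (b - 1 - l) A) • A ^ (l + 1)

lemma sum_range_sum_range_sub {M : Type*} [AddCommMonoid M] (b : ℕ) (f : ℕ → ℕ → M) :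
    ∑ j ∈ Finset.range (b + 1), ∑ l ∈ Finset.range (b - j), f j l =
      ∑ l ∈ Finset.range (b + 1), ∑ j ∈ Finset.range (b - l), f j l :=
  Finset.sum_comm' fun j l => by simp only [Finset.mem_range]; omega

lemma succ_smul_eigenEsymmGrad_succ (b : ℕ) (A : Matrix n n ℂ) :
    ((b : ℂ) + 1) • eigenEsymmGrad (b + 1) A =
      ∑ j ∈ Finset.range (b + 1), (-1 : ℂ) ^ j •
        (trace (A ^ (j + 1)) • eigenEsymmGrad (b - j) A +
          eigenEsymm (b - j) A • (((j + 1 : ℕ) : ℂ) • A ^ (j + 1))) := by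
  have key : ∑ j ∈ Finset.range (b + 1),
      (-1 : ℂ) ^ j • (trace (A ^ (j + 1)) • eigenEsymmGrad (b - j) A) =
      ∑ l ∈ Finset.range (b + 1),
        ((-1) ^ l * (((b : ℂ) - l) * eigenEsymm (b - l) A)) • A ^ (l + 1) := by
    simp only [eigenEsymmGrad, Finset.smul_sum]
    rw [sum_range_sum_range_sub]
    refine Finset.sum_congr rfl fun l hl => ?_
    rw [Finset.mem_range] at hl
    obtain hb | hb := Nat.eq_or_lt_of_le (Nat.lt_succ_iff.mp hl)
    · simp [hb]
    · obtain ⟨c, rfl⟩ : ∃ c, b = l + 1 + c := ⟨b - l - 1, by omega⟩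
      have e1 : l + 1 + c - l = c + 1 := by omega
      have hN := succ_mul_eigenEsymm_succ A c
      have e2 : (((l + 1 + c : ℕ) : ℂ) - l) = (c : ℂ) + 1 := by push_cast; ring
      rw [e1, e2, hN, Finset.mul_sum, Finset.sum_smul]
      refine Finset.sum_congr rfl fun j _ => ?_
      rw [smul_smul, smul_smul, show l + 1 + c - j - 1 - l = c - j by omega]
      congr 1
      ring
  simp only [smul_add, Finset.sum_add_distrib, key]
  rw [eigenEsymmGrad, Finset.smul_sum, ← Finset.sum_add_distrib]
  refine Finset.sum_congr rfl fun l _ => ?_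
  rw [smul_smul, smul_smul, smul_smul, ← add_smul, Nat.add_sub_cancel]
  congr 1
  push_cast
  ring

lemma hasTranslationGrad_eigenEsymm (b : ℕ) :
    HasTranslationGrad (n := n) (eigenEsymm b) (eigenEsymmGrad b) := by
  induction b using Nat.strong_induction_on with
  | _ b ih =>
    rcases b with _ | b
    · have h0 : (eigenEsymm 0 : Matrix n n ℂ → ℂ) = fun _ => 1 := funext eigenEsymm_zero
      have h1 : (eigenEsymmGrad 0 : Matrix n n ℂ → Matrix n n ℂ) = fun _ => 0 := by
        ext A; simp [eigenEsymmGrad]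
      rw [h0, h1]
      exact HasTranslationGrad.const 1
    · have h := (HasTranslationGrad.sum (Finset.range (b + 1)) fun j _ =>
        ((ih (b - j) (by omega)).mul (hasTranslationGrad_trace_pow (j + 1))).const_mul
          ((-1) ^ j)).const_mul ((b : ℂ) + 1)⁻¹
      have hb : (b : ℂ) + 1 ≠ 0 := Nat.cast_add_one_ne_zero b
      convert h using 1
      · ext A
        rw [eq_inv_mul_iff_mul_eq₀ hb, succ_mul_eigenEsymm_succ]
        exact Finset.sum_congr rfl fun j _ => mul_assoc _ _ _
      · funext A
        rw [← succ_smul_eigenEsymmGrad_succ, smul_smul, inv_mul_cancel₀ hb, one_smul]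

end TranslationGradient

section Invariance

open scoped Matrix.Norms.Operator

variable {n : Type*} [Fintype n] [DecidableEq n]

instance matrixBorelSpace {m k : Type*} [Countable m] [Countable k] :
    BorelSpace (Matrix m k ℂ) :=
  show BorelSpace (m → k → ℂ) from inferInstance

lemma exp_smul_mem_unitaryGroup {X : Matrix n n ℂ} (hX : star X = -X) (t : ℝ) :
    NormedSpace.exp (t • X) ∈ Matrix.unitaryGroup n ℂ := by
  rw [Matrix.mem_unitaryGroup_iff', Matrix.star_eq_conjTranspose, ← Matrix.exp_conjTranspose,
    Matrix.conjTranspose_smul, ← Matrix.star_eq_conjTranspose, hX, star_trivial, smul_neg,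
    Matrix.exp_neg]
  exact Matrix.nonsing_inv_mul _ ((Matrix.isUnit_iff_isUnit_det _).mp (Matrix.isUnit_exp _))

lemma isCompact_unitaryGroup : IsCompact {A : Matrix n n ℂ | A ∈ Matrix.unitaryGroup n ℂ} := by
  have hclosed : IsClosed {A : Matrix n n ℂ | A ∈ Matrix.unitaryGroup n ℂ} := isClosed_unitary
  refine Metric.isCompact_of_isClosed_isBounded hclosed ?_
  rw [isBounded_iff_forall_norm_le]
  have hK : IsCompact (Set.pi Set.univ fun _ : n => Set.pi Set.univ fun _ : n =>
      Metric.closedBall (0 : ℂ) 1) :=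
    isCompact_univ_pi fun _ => isCompact_univ_pi fun _ => isCompact_closedBall 0 1
  have hK' : IsCompact {A : Matrix n n ℂ | ∀ i j, ‖A i j‖ ≤ 1} := by
    have hset : {A : Matrix n n ℂ | ∀ i j, ‖A i j‖ ≤ 1} =
        Set.pi Set.univ fun _ : n => Set.pi Set.univ fun _ : n =>
          Metric.closedBall (0 : ℂ) 1 := by
      ext A
      exact ⟨fun h i _ j _ => mem_closedBall_zero_iff.mpr (h i j),
        fun h i j => mem_closedBall_zero_iff.mp (h i trivial j trivial)⟩
    rw [hset]
    exact hK
  obtain ⟨C, hC⟩ := isBounded_iff_forall_norm_le.mp hK'.isBounded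
  exact ⟨C, fun A hA => hC A fun i j => entry_norm_bound_of_unitary hA i j⟩

variable {μ : Measure (Matrix n n ℂ)} [IsProbabilityMeasure μ]

lemma ae_mem_unitaryGroup (hsupp : μ {A | A ∈ Matrix.unitaryGroup n ℂ} = 1) :
    ∀ᵐ A ∂μ, A ∈ Matrix.unitaryGroup n ℂ :=
  (mem_ae_iff_prob_eq_one isCompact_unitaryGroup.isClosed.measurableSet).mpr hsupp

lemma integrable_of_continuous (hsupp : μ {A | A ∈ Matrix.unitaryGroup n ℂ} = 1)
    {f : Matrix n n ℂ → ℂ} (hf : Continuous f) : Integrable f μ := by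
  obtain ⟨C, hC⟩ := isCompact_unitaryGroup.exists_bound_of_continuousOn
    (f := f) (hf.continuousOn (s := {A : Matrix n n ℂ | A ∈ Matrix.unitaryGroup n ℂ}))
  refine Integrable.of_bound hf.aestronglyMeasurable C ?_
  filter_upwards [ae_mem_unitaryGroup hsupp] with A hA using hC A hA

lemma integral_trace_mul_grad_of_skew
    (hsupp : μ {A | A ∈ Matrix.unitaryGroup n ℂ} = 1)
    (hinv : ∀ g ∈ Matrix.unitaryGroup n ℂ, μ.map (fun A => g * A) = μ)
    {F : Matrix n n ℂ → ℂ} {G : Matrix n n ℂ → Matrix n n ℂ}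
    (h : HasTranslationGrad F G) {X : Matrix n n ℂ} (hX : star X = -X) :
    ∫ A, trace (X * G A) ∂μ = 0 := by
  have hcont : Continuous fun A => trace (X * G A) :=
    (continuous_const.mul h.continuous_grad).matrix_trace
  have hmulc : ∀ t : ℝ, Continuous fun A : Matrix n n ℂ => NormedSpace.exp (t • X) * A :=
    fun t => continuous_const.mul continuous_id
  obtain ⟨C, hC⟩ := isCompact_unitaryGroup.exists_bound_of_continuousOn
    (hcont.continuousOn (s := {A : Matrix n n ℂ | A ∈ Matrix.unitaryGroup n ℂ}))
  have hconst : ∀ t : ℝ, ∫ A, F (NormedSpace.exp (t • X) * A) ∂μ = ∫ A, F A ∂μ := by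
    intro t
    conv_rhs => rw [← hinv _ (exp_smul_mem_unitaryGroup hX t)]
    rw [integral_map (hmulc t).aemeasurable h.continuous_fun.aestronglyMeasurable]
  have hder := (hasDerivAt_integral_of_dominated_loc_of_deriv_le (μ := μ) (𝕜 := ℝ)
    (F := fun t A => F (NormedSpace.exp (t • X) * A))
    (F' := fun t A => trace (X * G (NormedSpace.exp (t • X) * A)))
    (x₀ := 0) (s := Set.univ) (bound := fun _ => C) Filter.univ_mem
    (Filter.Eventually.of_forall fun t =>
      (h.continuous_fun.comp (hmulc t)).aestronglyMeasurable)
    (integrable_of_continuous hsupp (h.continuous_fun.comp (hmulc 0)))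
    (hcont.comp (hmulc 0)).aestronglyMeasurable ?_ (integrable_const C) ?_).2
  · simp only [hconst] at hder
    have := hder.unique (hasDerivAt_const (0 : ℝ) _)
    simpa using this
  · filter_upwards [ae_mem_unitaryGroup hsupp] with A hA t _
    exact hC _ (mul_mem (exp_smul_mem_unitaryGroup hX t) hA)
  · refine Filter.Eventually.of_forall fun A t _ => ?_
    have hs := h.hasDerivAt (NormedSpace.exp (t • X) * A) X hX
    rw [← sub_self t] at hs
    have hs' := hs.comp_sub_const t t
    refine hs'.congr_of_eventuallyEq (Filter.Eventually.of_forall fun u => ?_)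
    have hexp : NormedSpace.exp ((u - t) • X) * NormedSpace.exp (t • X) =
        NormedSpace.exp (u • X) := by
      rw [← Matrix.exp_add_of_commute _ _ (((Commute.refl X).smul_left _).smul_right _),
        ← add_smul, sub_add_cancel]
    simp only [← mul_assoc, hexp]

lemma integral_trace_mul_grad
    (hsupp : μ {A | A ∈ Matrix.unitaryGroup n ℂ} = 1)
    (hinv : ∀ g ∈ Matrix.unitaryGroup n ℂ, μ.map (fun A => g * A) = μ)
    {F : Matrix n n ℂ → ℂ} {G : Matrix n n ℂ → Matrix n n ℂ}
    (h : HasTranslationGrad F G) (X : Matrix n n ℂ) : ∫ A, trace (X * G A) ∂μ = 0 := by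
  have hInt : ∀ Y : Matrix n n ℂ, Integrable (fun A => trace (Y * G A)) μ := fun Y =>
    integrable_of_continuous hsupp (continuous_const.mul h.continuous_grad).matrix_trace
  have h1 := integral_trace_mul_grad_of_skew hsupp hinv h (X := X - star X) (by simp)
  have h2 := integral_trace_mul_grad_of_skew hsupp hinv h (X := Complex.I • (X + star X))
    (by simp [star_smul, add_comm])
  have hX : ∀ A, trace (X * G A) = (1 / 2) * trace ((X - star X) * G A) +
      (-Complex.I / 2) * trace ((Complex.I • (X + star X)) * G A) := by
    intro A
    simp only [sub_mul, add_mul, Matrix.smul_mul, Matrix.trace_sub, Matrix.trace_smul,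
      Matrix.trace_add, smul_eq_mul]
    linear_combination ((trace (X * G A) + trace (star X * G A)) / 2) * Complex.I_mul_I
  simp only [hX]
  rw [integral_add ((hInt _).const_mul _) ((hInt _).const_mul _), integral_const_mul,
    integral_const_mul, h1, h2]
  simp

/-- The Schwinger–Dyson equation for the vector field `A ↦ A ^ (j + 1)`. -/
lemma integral_schwinger_dyson
    (hsupp : μ {A | A ∈ Matrix.unitaryGroup n ℂ} = 1)
    (hinv : ∀ g ∈ Matrix.unitaryGroup n ℂ, μ.map (fun A => g * A) = μ)
    {F : Matrix n n ℂ → ℂ} {G : Matrix n n ℂ → Matrix n n ℂ}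
    (h : HasTranslationGrad F G) (j : ℕ) :
    ∫ A, (∑ m ∈ Finset.range (j + 1), trace (A ^ m) * trace (A ^ (j + 1 - m))) * F A +
      trace (A ^ (j + 1) * G A) ∂μ = 0 := by
  have hg : ∀ r s, HasTranslationGrad (fun A => (A ^ (j + 1)) r s * F A) (fun A =>
      F A • (∑ m ∈ Finset.range (j + 1), A ^ (j + 1 - m) * Matrix.single s r 1 * A ^ m) +
        (A ^ (j + 1)) r s • G A) :=
    fun r s => (hasTranslationGrad_pow_apply (j + 1) r s).mul h
  have h0 := fun r s =>
    integral_trace_mul_grad hsupp hinv (hg r s) (Matrix.single r s (1 : ℂ))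
  have hInt : ∀ r s, Integrable (fun A => trace (Matrix.single r s (1 : ℂ) *
      (F A • (∑ m ∈ Finset.range (j + 1), A ^ (j + 1 - m) * Matrix.single s r 1 * A ^ m) +
        (A ^ (j + 1)) r s • G A))) μ := fun r s =>
    integrable_of_continuous hsupp (continuous_const.mul (hg r s).continuous_grad).matrix_trace
  have hsum : ∫ A, ∑ r, ∑ s, trace (Matrix.single r s (1 : ℂ) *
      (F A • (∑ m ∈ Finset.range (j + 1), A ^ (j + 1 - m) * Matrix.single s r 1 * A ^ m) +
        (A ^ (j + 1)) r s • G A)) ∂μ = 0 := by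
    rw [integral_finsetSum _ fun r _ => integrable_finsetSum _ fun s _ => hInt r s]
    refine Finset.sum_eq_zero fun r _ => ?_
    rw [integral_finsetSum _ fun s _ => hInt r s]
    exact Finset.sum_eq_zero fun s _ => h0 r s
  rw [← hsum]
  refine integral_congr_ae (Filter.Eventually.of_forall fun A => ?_)
  have e1 : ∀ (r s : n) (m : ℕ), trace (Matrix.single r s (1 : ℂ) *
      (A ^ (j + 1 - m) * Matrix.single s r 1 * A ^ m)) =
      (A ^ m) r r * (A ^ (j + 1 - m)) s s := by
    intro r s m
    rw [Matrix.trace_single_mul, Matrix.mul_assoc, Matrix.mul_apply,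
      Finset.sum_eq_single s]
    · simp [mul_comm]
    · intro x _ hx
      simp [hx]
    · simp
  simp only [mul_add, Matrix.mul_smul, Finset.mul_sum, Matrix.trace_add, Matrix.trace_smul,
    Matrix.trace_sum, e1, Matrix.trace_single_mul, smul_eq_mul, Finset.sum_add_distrib]
  congr 1
  · rw [Finset.sum_mul]
    rw [Finset.sum_congr rfl fun x _ => Finset.sum_comm, Finset.sum_comm]
    refine Finset.sum_congr rfl fun m _ => ?_
    simp only [Matrix.trace, Matrix.diag_apply]
    rw [Finset.sum_mul_sum, Finset.sum_mul]
    simp only [Finset.sum_mul]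
    exact Finset.sum_congr rfl fun r _ => Finset.sum_congr rfl fun s _ => mul_comm _ _
  · simp [Matrix.trace, Matrix.mul_apply]

end Invariance

section Recursion

/-- The values of the mixed moments `(-1) ^ i * E[eᵢ pₐ conj(pₐ₊ᵢ)]` for `i ≤ N`. -/
def mixedMoment (N i a : ℕ) : ℂ :=
  if a = 0 then (if i = 0 then (N : ℂ) ^ 2 else -N)
  else if i = 0 then (min a N : ℕ) else if N < a + i then -1 else 0

lemma sum_mixedMoment_zero (N b : ℕ) :
    ∑ i ∈ Finset.range (b + 1), mixedMoment N i 0 = N * ((N : ℂ) - b) := by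
  induction b with
  | zero => simp [mixedMoment, sq]
  | succ b ih =>
    rw [Finset.sum_range_succ, ih]
    simp only [mixedMoment, if_true, Nat.add_eq_zero_iff, one_ne_zero, and_false, if_false]
    push_cast
    ring

lemma sum_mixedMoment {N b a : ℕ} (ha : a ≠ 0) (hb : b ≤ N) :
    ∑ i ∈ Finset.range (b + 1), mixedMoment N i a =
      if N ≤ a + b then (N : ℂ) - b else a := by
  induction b with
  | zero =>
    by_cases h : N ≤ a
    · simp [mixedMoment, ha, h]
    · simp [mixedMoment, ha, h, (not_le.mp h).le]
  | succ b ih =>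
    rw [Finset.sum_range_succ, ih (by omega)]
    simp only [mixedMoment, if_neg ha, Nat.add_eq_zero_iff, one_ne_zero, and_false, if_false]
    rcases lt_trichotomy N (a + (b + 1)) with h | h | h
    · rw [if_pos (by omega), if_pos h, if_pos h.le]
      push_cast
      ring
    · rw [if_neg (by omega), if_neg h.not_lt, if_pos h.le, h]
      push_cast
      ring
    · rw [if_neg (by omega), if_neg h.not_gt, if_neg (by omega), add_zero]

variable {N : ℕ} {U : ℕ → ℕ → ℂ}

lemma eq_mixedMoment_of_recursion (hN : 1 ≤ N) (h0 : U 0 0 = (N : ℂ) ^ 2)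
    (hR : ∀ b a : ℕ, (a : ℂ) * ∑ i ∈ Finset.range (b + 1), U i (a + b + 1 - i) =
      ((b : ℂ) + 1) * (N - b) * U (b + 1) a +
        ((a : ℂ) + b + 1) * ∑ i ∈ Finset.range (b + 1), U i a)
    (hC : ∀ m : ℕ, ∑ i ∈ Finset.range (N + 1), U i (m + N - i) = 0)
    (hNewton : ∀ b : ℕ, (N : ℂ) * ∑ i ∈ Finset.range (b + 1), U i (b + 1 - i) =
      -((b : ℂ) + 1) * U (b + 1) 0) (k : ℕ) :
    ∀ i a, a + i = k → i ≤ N → U i a = mixedMoment N i a := by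
  induction k using Nat.strong_induction_on with
  | _ k ih =>
  obtain rfl | hk := Nat.eq_zero_or_pos k
  · intro i a h _
    obtain ⟨rfl, rfl⟩ : a = 0 ∧ i = 0 := by omega
    simp [h0, mixedMoment]
  have hN0 : (N : ℂ) ≠ 0 := Nat.cast_ne_zero.mpr (by omega)
  have hS : ∀ b a, a + b + 1 = k → b < N → ∑ i ∈ Finset.range (b + 1), U i a =
      ∑ i ∈ Finset.range (b + 1), mixedMoment N i a := fun b a h hb =>
    Finset.sum_congr rfl fun i hi => by
      rw [Finset.mem_range] at hi
      exact ih (a + i) (by omega) i a rfl (by omega)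
  set T : ℕ → ℂ := fun b => ∑ i ∈ Finset.range (b + 1), U i (k - i) with hT
  have hT0 : T 0 = U 0 k := by simp [hT]
  have hTs : ∀ b, T (b + 1) = T b + U (b + 1) (k - (b + 1)) := fun b =>
    Finset.sum_range_succ _ _
  have hRT : ∀ b a, a + b + 1 = k → b < N → (a : ℂ) * T b =
      ((b : ℂ) + 1) * (N - b) * (T (b + 1) - T b) +
        ((a : ℂ) + b + 1) * ∑ i ∈ Finset.range (b + 1), mixedMoment N i a := by
    intro b a h hb
    have := hR b a
    rw [hS b a h hb, h] at this
    rw [hTs, add_sub_cancel_left, show k - (b + 1) = a by omega]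
    exact this
  have hcoef : ∀ b a : ℕ, a ≠ 0 → b < N → (a : ℂ) + (b + 1) * (N - b) ≠ 0 := by
    intro b a ha hb
    obtain ⟨c, rfl⟩ := Nat.exists_eq_add_of_lt hb
    have : (a : ℂ) + (b + 1) * (((b + c + 1 : ℕ) : ℂ) - b) =
        ((a + (b + 1) * (c + 1) : ℕ) : ℂ) := by
      push_cast
      ring
    rw [this]
    exact Nat.cast_ne_zero.mpr (by omega)
  rcases lt_or_ge N k with hNk | hkN
  · have hTN : T N = 0 := by
      have := hC (k - N)
      rwa [Nat.sub_add_cancel hNk.le] at this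
    have hTb : ∀ c b, b + c = N → T b = (N : ℂ) - b := by
      intro c
      induction c with
      | zero =>
        rintro b rfl
        simpa using hTN
      | succ c ihc =>
        intro b hb
        have h := hRT b (k - b - 1) (by omega) (by omega)
        rw [ihc (b + 1) (by omega), sum_mixedMoment (by omega) (by omega),
          if_pos (by omega)] at h
        refine mul_left_cancel₀ (hcoef b (k - b - 1) (by omega) (by omega)) ?_
        push_cast at h
        linear_combination h
    intro i a hia hi
    rcases i with _ | i
    · obtain rfl : a = k := by omega
      rw [← hT0, hTb N 0 (by omega)]
      simp [mixedMoment, hk.ne', hNk.le]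
    · have h1 := hTs i
      rw [show k - (i + 1) = a by omega, hTb (N - i) i (by omega),
        hTb (N - (i + 1)) (i + 1) (by omega)] at h1
      rw [mixedMoment, if_neg (by omega), if_neg (by omega), if_pos (by omega)]
      push_cast at h1
      linear_combination -h1
  · obtain ⟨q, rfl⟩ : ∃ q, k = q + 1 := ⟨k - 1, by omega⟩
    have hq : ((q : ℂ) + 1) ≠ 0 := Nat.cast_add_one_ne_zero q
    have hNq : (N : ℂ) - q ≠ 0 := by
      rw [sub_ne_zero]
      exact Nat.cast_injective.ne (by omega)
    have hUk : U (q + 1) 0 = -N := by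
      have h := hR q 0
      rw [hS q 0 (by omega) (by omega), sum_mixedMoment_zero] at h
      refine mul_left_cancel₀ (mul_ne_zero hq hNq) ?_
      push_cast at h
      linear_combination -h
    have hTq : T q = (q + 1 : ℕ) := by
      refine mul_left_cancel₀ hN0 ?_
      rw [hT, hNewton, hUk]
      push_cast
      ring
    have hTb : ∀ c b, b + c = q → T b = (q + 1 : ℕ) := by
      intro c
      induction c with
      | zero =>
        rintro b rfl
        exact hTq
      | succ c ihc =>
        intro b hb
        have h := hRT b (q - b) (by omega) (by omega)
        have hc : ((q - b : ℕ) : ℂ) = (q : ℂ) - b := Nat.cast_sub (by omega)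
        rw [ihc (b + 1) (by omega), sum_mixedMoment (by omega) (by omega),
          if_neg (by omega)] at h
        refine mul_left_cancel₀ (hcoef b (q - b) (by omega) (by omega)) ?_
        rw [hc] at h ⊢
        push_cast at h ⊢
        linear_combination h
    intro i a hia hi
    rcases i with _ | i
    · obtain rfl : a = q + 1 := by omega
      rw [← hT0, hTb q 0 (by omega)]
      simp [mixedMoment, hkN]
    · rcases a with _ | a
      · obtain rfl : i = q := by omega
        simp [mixedMoment, hUk]
      · have h1 := hTs i
        rw [show q + 1 - (i + 1) = a + 1 by omega, hTb (q - i) i (by omega),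
          hTb (q - (i + 1)) (i + 1) (by omega)] at h1
        rw [mixedMoment, if_neg (by omega), if_neg (by omega), if_neg (by omega)]
        linear_combination -h1

end Recursion

section MixedMoments

lemma sum_range_sum_range {M : Type*} [AddCommMonoid M] (b : ℕ) (g : ℕ → ℕ → M) :
    ∑ j ∈ Finset.range (b + 1), ∑ m ∈ Finset.range j, g j m =
      ∑ m ∈ Finset.range (b + 1), ∑ r ∈ Finset.range (b - m), g (m + 1 + r) m := by
  induction b with
  | zero => simp
  | succ b ih =>
    rw [Finset.sum_range_succ, ih, Finset.sum_range_succ _ (b + 1), Nat.sub_self,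
      Finset.sum_range_zero, add_zero, ← Finset.sum_add_distrib]
    refine Finset.sum_congr rfl fun m hm => ?_
    have hm' : m ≤ b := Nat.lt_succ_iff.mp (Finset.mem_range.mp hm)
    rw [Nat.sub_add_comm hm', Finset.sum_range_succ]
    congr 2
    omega

variable {n : Type*} [Fintype n] [DecidableEq n]

lemma sum_eigenEsymm_mul_sum_trace_pow (b : ℕ) (A : Matrix n n ℂ) :
    ∑ j ∈ Finset.range (b + 1), (-1) ^ j * (eigenEsymm (b - j) A *
      ∑ m ∈ Finset.range (j + 1), trace (A ^ m) * trace (A ^ (j + 1 - m))) =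
    Fintype.card n * (((b : ℂ) + 1) * eigenEsymm (b + 1) A) +
      ∑ m ∈ Finset.range (b + 1),
        (-1) ^ (m + 1) * (((b : ℂ) - m) * eigenEsymm (b - m) A) * trace (A ^ (m + 1)) := by
  simp only [Finset.sum_range_succ' (fun m => trace (A ^ m) * trace (A ^ (_ - m))), mul_add,
    Finset.sum_add_distrib, Nat.sub_zero, pow_zero, Matrix.trace_one]
  rw [add_comm, succ_mul_eigenEsymm_succ, Finset.mul_sum]
  congr 1
  · exact Finset.sum_congr rfl fun j _ => by ring
  · simp only [Finset.mul_sum]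
    rw [sum_range_sum_range]
    refine Finset.sum_congr rfl fun m hm => ?_
    rw [Finset.mem_range] at hm
    obtain hb | hb := Nat.eq_or_lt_of_le (Nat.lt_succ_iff.mp hm)
    · simp [hb]
    · obtain ⟨c, rfl⟩ : ∃ c, b = m + 1 + c := ⟨b - m - 1, by omega⟩
      have e1 : m + 1 + c - m = c + 1 := by omega
      have e2 : (((m + 1 + c : ℕ) : ℂ) - m) = (c : ℂ) + 1 := by push_cast; ring
      rw [e1, e2, succ_mul_eigenEsymm_succ, Finset.mul_sum, Finset.sum_mul]
      refine Finset.sum_congr rfl fun r _ => ?_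
      rw [show m + 1 + c - (m + 1 + r) = c - r by omega,
        show m + 1 + r + 1 - (m + 1) = r + 1 by omega]
      ring

lemma sum_trace_pow_mul_eigenEsymmGrad (b : ℕ) (A : Matrix n n ℂ) :
    ∑ j ∈ Finset.range (b + 1), (-1) ^ j * trace (A ^ (j + 1) * eigenEsymmGrad (b - j) A) =
      ∑ m ∈ Finset.range (b + 1),
        (-1) ^ (m + 1) * ((m : ℂ) * eigenEsymm (b - m) A) * trace (A ^ (m + 1)) := by
  have h := sum_range_sum_range b fun m _ =>
    (-1) ^ (m + 1) * eigenEsymm (b - m) A * trace (A ^ (m + 1))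
  simp only [Finset.sum_const, Finset.card_range, nsmul_eq_mul] at h
  calc _ = _ := ?_
    _ = _ := h.symm
    _ = _ := Finset.sum_congr rfl fun m _ => by ring
  refine Finset.sum_congr rfl fun j _ => ?_
  simp only [eigenEsymmGrad, Finset.mul_sum, Matrix.trace_sum, Matrix.mul_smul,
    Matrix.trace_smul, ← pow_add, smul_eq_mul]
  refine Finset.sum_congr rfl fun r _ => ?_
  rw [show b - j - 1 - r = b - (j + 1 + r) by omega,
    show j + 1 + (r + 1) = j + 1 + r + 1 by omega]
  ring

/-- The divergence of the vector field `A ↦ ∑ j ≤ b, (-1) ^ j e_{b-j}(A) A ^ (j + 1)`. -/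
lemma sum_divergence_eigenEsymm (b : ℕ) (A : Matrix n n ℂ) :
    ∑ j ∈ Finset.range (b + 1), (-1) ^ j * (eigenEsymm (b - j) A *
        (∑ m ∈ Finset.range (j + 1), trace (A ^ m) * trace (A ^ (j + 1 - m))) +
      trace (A ^ (j + 1) * eigenEsymmGrad (b - j) A)) =
    ((b : ℂ) + 1) * (Fintype.card n - b) * eigenEsymm (b + 1) A := by
  simp only [mul_add ((-1 : ℂ) ^ _), Finset.sum_add_distrib]
  rw [sum_eigenEsymm_mul_sum_trace_pow, sum_trace_pow_mul_eigenEsymmGrad, add_assoc,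
    ← Finset.sum_add_distrib]
  have h : ∑ m ∈ Finset.range (b + 1),
      ((-1) ^ (m + 1) * (((b : ℂ) - m) * eigenEsymm (b - m) A) * trace (A ^ (m + 1)) +
        (-1) ^ (m + 1) * ((m : ℂ) * eigenEsymm (b - m) A) * trace (A ^ (m + 1))) =
      -(b : ℂ) * (((b : ℂ) + 1) * eigenEsymm (b + 1) A) := by
    rw [succ_mul_eigenEsymm_succ, Finset.mul_sum]
    exact Finset.sum_congr rfl fun m _ => by ring
  rw [h]
  ring

lemma trace_pow_mul_star_pow {A : Matrix n n ℂ} (hA : A ∈ Matrix.unitaryGroup n ℂ) (i j : ℕ) :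
    trace (A ^ i * star A ^ (i + j)) = star (trace (A ^ j)) := by
  have h1 : A * star A = 1 := (Matrix.mem_unitaryGroup_iff).mp hA
  have h2 : star A * A = 1 := (Matrix.mem_unitaryGroup_iff').mp hA
  have hc : Commute A (star A) := h1.trans h2.symm
  rw [pow_add, ← mul_assoc, ← hc.mul_pow, h1, one_pow, one_mul, ← star_pow,
    Matrix.star_eq_conjTranspose, Matrix.trace_conjTranspose]

/-- The signed product `(-1) ^ i eᵢ pₐ conj(pₐ₊ᵢ)`, with `eᵢ` the elementary symmetric functions
and `pₐ` the power sums of the eigenvalues. -/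
def mixedTrace (i a : ℕ) (A : Matrix n n ℂ) : ℂ :=
  (-1) ^ i * (eigenEsymm i A * (trace (A ^ a) * star (trace (A ^ (a + i)))))

open scoped Matrix.Norms.Operator in
lemma continuous_mixedTrace (i a : ℕ) : Continuous (mixedTrace (n := n) i a) :=
  continuous_const.mul ((hasTranslationGrad_eigenEsymm i).continuous_fun.mul
    ((hasTranslationGrad_trace_pow a).continuous_fun.mul
      (hasTranslationGrad_star_trace_pow (a + i)).continuous_fun))

lemma sum_range_neg_one_pow_mul_sub (b : ℕ) (f : ℕ → ℂ) :
    ∑ j ∈ Finset.range (b + 1), (-1) ^ j * f (b - j) =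
      (-1) ^ b * ∑ i ∈ Finset.range (b + 1), (-1) ^ i * f i := by
  rw [← Finset.sum_range_reflect, Finset.mul_sum]
  refine Finset.sum_congr rfl fun i hi => ?_
  have hi' : i ≤ b := Nat.lt_succ_iff.mp (Finset.mem_range.mp hi)
  obtain ⟨c, rfl⟩ := Nat.exists_eq_add_of_le hi'
  rw [show i + c + 1 - 1 - i = c by omega, show i + c - c = i by omega, pow_add, ← mul_assoc]
  congr 1
  linear_combination (-(-1 : ℂ) ^ c) * (Even.neg_one_pow (α := ℂ) ⟨i, rfl⟩ : (-1 : ℂ) ^ (i + i) = 1)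

lemma sum_schwinger_dyson_integrand {A : Matrix n n ℂ} (hA : A ∈ Matrix.unitaryGroup n ℂ)
    (b a : ℕ) :
    ∑ j ∈ Finset.range (b + 1), (-1) ^ j *
      ((∑ m ∈ Finset.range (j + 1), trace (A ^ m) * trace (A ^ (j + 1 - m))) *
          (eigenEsymm (b - j) A * (trace (A ^ a) * star (trace (A ^ (a + b + 1))))) +
        trace (A ^ (j + 1) *
          ((trace (A ^ a) * star (trace (A ^ (a + b + 1)))) • eigenEsymmGrad (b - j) A +
            eigenEsymm (b - j) A • (star (trace (A ^ (a + b + 1))) • (a : ℂ) • A ^ a +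
              trace (A ^ a) • -((a + b + 1 : ℕ) : ℂ) • star A ^ (a + b + 1))))) =
      (-1) ^ b * (a * ∑ i ∈ Finset.range (b + 1), mixedTrace i (a + b + 1 - i) A -
        (((b : ℂ) + 1) * (Fintype.card n - b) * mixedTrace (b + 1) a A +
          ((a : ℂ) + b + 1) * ∑ i ∈ Finset.range (b + 1), mixedTrace i a A)) := by
  have hdiv := sum_divergence_eigenEsymm b A
  have hrefl := sum_range_neg_one_pow_mul_sub b fun i => eigenEsymm i A *
    (a * (trace (A ^ (a + b + 1 - i)) * star (trace (A ^ (a + b + 1)))) -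
      ((a : ℂ) + b + 1) * (trace (A ^ a) * star (trace (A ^ (a + i)))))
  calc _ = ∑ j ∈ Finset.range (b + 1), ((-1) ^ j * (eigenEsymm (b - j) A *
          (∑ m ∈ Finset.range (j + 1), trace (A ^ m) * trace (A ^ (j + 1 - m))) +
        trace (A ^ (j + 1) * eigenEsymmGrad (b - j) A)) *
          (trace (A ^ a) * star (trace (A ^ (a + b + 1)))) +
        (-1) ^ j * (eigenEsymm (b - j) A *
          (a * (trace (A ^ (a + b + 1 - (b - j))) * star (trace (A ^ (a + b + 1)))) -
            ((a : ℂ) + b + 1) * (trace (A ^ a) * star (trace (A ^ (a + (b - j)))))))) := ?_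
    _ = _ := ?_
  · refine Finset.sum_congr rfl fun j hj => ?_
    have hj' : j ≤ b := Nat.lt_succ_iff.mp (Finset.mem_range.mp hj)
    have hs := trace_pow_mul_star_pow hA (j + 1) (a + (b - j))
    rw [show j + 1 + (a + (b - j)) = a + b + 1 by omega] at hs
    rw [show a + b + 1 - (b - j) = j + 1 + a by omega, ← hs]
    simp only [mul_add, Matrix.mul_smul, Matrix.trace_add, Matrix.trace_smul, smul_eq_mul,
      ← pow_add]
    push_cast
    ring
  · have hs : ∑ i ∈ Finset.range (b + 1), (-1) ^ i * (eigenEsymm i A *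
        (a * (trace (A ^ (a + b + 1 - i)) * star (trace (A ^ (a + b + 1)))) -
          ((a : ℂ) + b + 1) * (trace (A ^ a) * star (trace (A ^ (a + i)))))) =
        a * ∑ i ∈ Finset.range (b + 1), mixedTrace i (a + b + 1 - i) A -
          ((a : ℂ) + b + 1) * ∑ i ∈ Finset.range (b + 1), mixedTrace i a A := by
      simp only [mixedTrace, Finset.mul_sum, ← Finset.sum_sub_distrib]
      refine Finset.sum_congr rfl fun i hi => ?_
      rw [Nat.sub_add_cancel (by have := Finset.mem_range.mp hi; omega)]
      ring
    have h1 : (-1 : ℂ) ^ b * (-1) ^ b = 1 := by rw [← mul_pow]; simp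
    rw [Finset.sum_add_distrib, ← Finset.sum_mul, hdiv, hrefl, hs, mixedTrace,
      pow_succ (-1 : ℂ), ← add_assoc]
    linear_combination -(((b : ℂ) + 1) * (Fintype.card n - b) * eigenEsymm (b + 1) A *
      (trace (A ^ a) * star (trace (A ^ (a + b + 1))))) * h1

open scoped Matrix.Norms.Operator

variable {μ : Measure (Matrix n n ℂ)} [IsProbabilityMeasure μ]

lemma integrable_mixedTrace (hsupp : μ {A | A ∈ Matrix.unitaryGroup n ℂ} = 1) (i a : ℕ) :
    Integrable (mixedTrace (n := n) i a) μ :=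
  integrable_of_continuous hsupp (continuous_mixedTrace i a)

lemma integral_mixedTrace_recursion
    (hsupp : μ {A | A ∈ Matrix.unitaryGroup n ℂ} = 1)
    (hinv : ∀ g ∈ Matrix.unitaryGroup n ℂ, μ.map (fun A => g * A) = μ) (b a : ℕ) :
    (a : ℂ) * ∑ i ∈ Finset.range (b + 1), ∫ A, mixedTrace i (a + b + 1 - i) A ∂μ =
      ((b : ℂ) + 1) * (Fintype.card n - b) * ∫ A, mixedTrace (b + 1) a A ∂μ +
        ((a : ℂ) + b + 1) * ∑ i ∈ Finset.range (b + 1), ∫ A, mixedTrace i a A ∂μ := by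
  have hmt := integrable_mixedTrace hsupp
  have hms : ∀ (c : ℂ) (f : ℕ → ℕ), Integrable
      (fun A => c * ∑ i ∈ Finset.range (b + 1), mixedTrace i (f i) A) μ := fun c f =>
    (integrable_finsetSum _ fun i _ => hmt i (f i)).const_mul c
  have hadd : Integrable (fun A => ((b : ℂ) + 1) * (Fintype.card n - b) * mixedTrace (b + 1) a A +
      ((a : ℂ) + b + 1) * ∑ i ∈ Finset.range (b + 1), mixedTrace i a A) μ :=
    ((hmt _ _).const_mul _).add (hms _ fun _ => a)
  have hg := fun j => (hasTranslationGrad_eigenEsymm (n := n) (b - j)).mul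
    ((hasTranslationGrad_trace_pow a).mul (hasTranslationGrad_star_trace_pow (a + b + 1)))
  have hSD := fun j => integral_schwinger_dyson hsupp hinv (hg j) j
  have hInt := fun j => integrable_of_continuous hsupp
    (((continuous_finsetSum (Finset.range (j + 1)) fun m _ =>
      ((continuous_pow (M := Matrix n n ℂ) m).matrix_trace.mul
        (continuous_pow (M := Matrix n n ℂ) (j + 1 - m)).matrix_trace)).mul
          (hg j).continuous_fun).add
        ((continuous_pow (j + 1)).mul (hg j).continuous_grad).matrix_trace)
  have hsum := integral_finsetSum (μ := μ) (Finset.range (b + 1)) fun j _ =>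
    (hInt j).const_mul ((-1 : ℂ) ^ j)
  simp only [integral_const_mul] at hsum
  simp only [Pi.add_apply, Pi.mul_apply] at hsum
  rw [Finset.sum_eq_zero fun j _ => by rw [hSD, mul_zero]] at hsum
  rw [integral_congr_ae ((ae_mem_unitaryGroup hsupp).mono fun A hA =>
      sum_schwinger_dyson_integrand hA b a), integral_const_mul, mul_eq_zero_iff_left
      (pow_ne_zero _ (neg_ne_zero.mpr one_ne_zero)),
    integral_sub (hms _ fun i => a + b + 1 - i) hadd,
    integral_add ((hmt _ _).const_mul _) (hms _ fun _ => a),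
    integral_const_mul, integral_const_mul, integral_const_mul,
    integral_finsetSum _ fun i _ => hmt i _, integral_finsetSum _ fun i _ => hmt i _,
    sub_eq_zero] at hsum
  exact hsum

lemma sum_integral_mixedTrace_card (hsupp : μ {A | A ∈ Matrix.unitaryGroup n ℂ} = 1) (m : ℕ) :
    ∑ i ∈ Finset.range (Fintype.card n + 1),
      ∫ A, mixedTrace i (m + Fintype.card n - i) A ∂μ = 0 := by
  rw [← integral_finsetSum _ fun i _ => integrable_mixedTrace hsupp i _]
  refine integral_eq_zero_of_ae ((ae_mem_unitaryGroup hsupp).mono fun A hA => ?_)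
  have hu : IsUnit A :=
    IsUnit.of_mul_eq_one _ (Matrix.mem_unitaryGroup_iff.mp hA)
  have h := sum_eigenEsymm_mul_trace_pow_eq_zero A hu m
  have hr := sum_range_neg_one_pow_mul_sub (Fintype.card n) fun i =>
    eigenEsymm i A * trace (A ^ (m + Fintype.card n - i))
  rw [Finset.sum_congr rfl (g := fun j => (-1) ^ j * eigenEsymm (Fintype.card n - j) A *
    trace (A ^ (m + j))) fun j hj => ?_, h] at hr
  · have h0 := (mul_eq_zero_iff_left (pow_ne_zero _ (neg_ne_zero.mpr one_ne_zero))).mp hr.symm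
    rw [Pi.zero_apply, ← zero_mul (star (trace (A ^ (m + Fintype.card n)))), ← h0,
      Finset.sum_mul]
    refine Finset.sum_congr rfl fun i hi => ?_
    rw [mixedTrace, Nat.sub_add_cancel (by have := Finset.mem_range.mp hi; omega)]
    ring
  · rw [show m + Fintype.card n - (Fintype.card n - j) = m + j by
      have := Finset.mem_range.mp hj; omega, mul_assoc]

lemma sum_integral_mixedTrace_succ (hsupp : μ {A | A ∈ Matrix.unitaryGroup n ℂ} = 1) (b : ℕ) :
    (Fintype.card n : ℂ) * ∑ i ∈ Finset.range (b + 1), ∫ A, mixedTrace i (b + 1 - i) A ∂μ =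
      -((b : ℂ) + 1) * ∫ A, mixedTrace (b + 1) 0 A ∂μ := by
  rw [← integral_finsetSum _ fun i _ => integrable_mixedTrace hsupp i _, ← integral_const_mul,
    ← integral_const_mul]
  congr 1
  ext A
  have h := succ_mul_eigenEsymm_succ A b
  have hr := sum_range_neg_one_pow_mul_sub b fun i => eigenEsymm i A * trace (A ^ (b + 1 - i))
  rw [Finset.sum_congr rfl (g := fun j => (-1) ^ j * eigenEsymm (b - j) A *
    trace (A ^ (j + 1))) fun j hj => ?_, ← h] at hr
  · have hs : ∑ i ∈ Finset.range (b + 1), mixedTrace i (b + 1 - i) A =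
        (∑ i ∈ Finset.range (b + 1), (-1) ^ i * (eigenEsymm i A * trace (A ^ (b + 1 - i)))) *
          star (trace (A ^ (b + 1))) := by
      rw [Finset.sum_mul]
      refine Finset.sum_congr rfl fun i hi => ?_
      rw [mixedTrace, Nat.sub_add_cancel (by have := Finset.mem_range.mp hi; omega)]
      ring
    have h1 : (-1 : ℂ) ^ b * (-1) ^ b = 1 := by rw [← mul_pow]; simp
    rw [hs, mixedTrace, zero_add, pow_zero, Matrix.trace_one, pow_succ (-1 : ℂ)]
    linear_combination (-(Fintype.card n : ℂ) * star (trace (A ^ (b + 1))) * (-1) ^ b) * hr -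
      (Fintype.card n * star (trace (A ^ (b + 1))) * ∑ i ∈ Finset.range (b + 1),
        (-1) ^ i * (eigenEsymm i A * trace (A ^ (b + 1 - i)))) * h1
  · rw [show b + 1 - (b - j) = j + 1 by have := Finset.mem_range.mp hj; omega, mul_assoc]

lemma integral_normSq_trace_pow [Nonempty n]
    (hsupp : μ {A | A ∈ Matrix.unitaryGroup n ℂ} = 1)
    (hinv : ∀ g ∈ Matrix.unitaryGroup n ℂ, μ.map (fun A => g * A) = μ) {k : ℕ} (hk : 1 ≤ k) :
    ∫ A, ‖trace (A ^ k)‖ ^ 2 ∂μ = min (k : ℝ) (Fintype.card n : ℝ) := by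
  have hU := eq_mixedMoment_of_recursion (N := Fintype.card n)
    (U := fun i a => ∫ A, mixedTrace i a A ∂μ) Fintype.card_pos
    (by simp [mixedTrace, eigenEsymm_zero, sq])
    (integral_mixedTrace_recursion hsupp hinv) (sum_integral_mixedTrace_card hsupp)
    (sum_integral_mixedTrace_succ hsupp) k 0 k rfl (Nat.zero_le _)
  have hnorm : ∀ A : Matrix n n ℂ, mixedTrace 0 k A = ((‖trace (A ^ k)‖ ^ 2 : ℝ) : ℂ) := by
    intro A
    rw [mixedTrace, eigenEsymm_zero, ← Complex.normSq_eq_norm_sq, ← Complex.mul_conj]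
    simp
  simp only [hnorm, mixedMoment, if_neg (Nat.one_le_iff_ne_zero.mp hk), if_true,
    integral_complex_ofReal] at hU
  rw [← Nat.cast_min]
  exact Complex.ofReal_injective (hU.trans (Complex.ofReal_natCast _).symm)

end MixedMoments

/-- Let `N ≥ 1` and let `A` be a random matrix distributed according to the normalized Haar
probability measure on the unitary group `U(N)`. Then for every integer `k ≥ 1`,
`E[|Tr(A^k)|²] = min {k, N}`. -/
theorem expected_sq_abs_trace_pow_unitary
    (N : ℕ) (hN : 1 ≤ N)
    (μ : Measure (Matrix (Fin N) (Fin N) ℂ)) [IsProbabilityMeasure μ]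
    (hsupp : μ {A | A ∈ Matrix.unitaryGroup (Fin N) ℂ} = 1)
    (hinv : ∀ g ∈ Matrix.unitaryGroup (Fin N) ℂ, μ.map (fun A => g * A) = μ) :
    ∀ k : ℕ, 1 ≤ k → ∫ A, ‖(A ^ k).trace‖ ^ 2 ∂μ = min (k : ℝ) (N : ℝ) := by
  intro k hk
  have : Nonempty (Fin N) := ⟨⟨0, hN⟩⟩
  simpa using integral_normSq_trace_pow hsupp hinv hk
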